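/- Let R be a finite ring of characteristic 2 whose unit group Rˣ has trivial 2-core (i.e., the only normal subgroup of Rˣ that is a 2-group is the trivial subgroup). Then R is isomorphic as a ring to a finite direct product M_{n₁}(F₁) × ⋯ × M_{n_r}(F_r) of matrix rings over finite fields F₁,…,F_r of characteristic 2. -/

import Mathlib

lemma aux_semisimple (R : Type) [Ring R] [Finite R] (hchar : (1 : R) + 1 = 0)
    (h2core : ∀ N : Subgroup Rˣ, N.Normal → IsPGroup 2 N → N = ⊥) : IsSemisimpleRing R := by
  rcases subsingleton_or_nontrivial R with hs | hn
  · rw [IsArtinianRing.isSemisimpleRing_iff_jacobson]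
    exact Subsingleton.elim _ _
  have : CharP R 2 := CharTwo.of_one_ne_zero_of_two_eq_zero one_ne_zero
    (by rw [← one_add_one_eq_two]; exact hchar)
  have hnil : ∀ x ∈ Ring.jacobson R, IsNilpotent x := by
    intro x hx
    obtain ⟨n, hn⟩ := IsSemiprimaryRing.isNilpotent (R := R)
    exact ⟨n, by simpa [hn] using Ideal.pow_mem_pow hx n⟩
  let f : R →+* R ⧸ Ring.jacobson R := Ideal.Quotient.mk _
  have hN := h2core (Units.map (f : R →* R ⧸ Ring.jacobson R)).ker inferInstance (by
    rintro ⟨u, hu⟩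
    have h1 : (u : R) - 1 ∈ Ring.jacobson R := by
      have := congrArg Units.val (MonoidHom.mem_ker.1 hu)
      rw [← Ideal.Quotient.eq]
      simpa [f] using this
    obtain ⟨n, hn⟩ := hnil _ h1
    refine ⟨n, ?_⟩
    ext
    have h2 := sub_pow_char_pow_of_commute (p := 2) (n := n) (Commute.one_right (u : R))
    rw [pow_eq_zero_of_le Nat.lt_two_pow_self.le hn] at h2
    simpa using (sub_eq_zero.1 h2.symm))
  rw [IsArtinianRing.isSemisimpleRing_iff_jacobson, eq_bot_iff]
  intro x hx
  have hu : IsUnit (1 + x) := by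
    exact IsNilpotent.isUnit_one_add (hnil x hx)
  obtain ⟨u, hu⟩ := hu
  have : u ∈ (Units.map (f : R →* R ⧸ Ring.jacobson R)).ker := by
    rw [MonoidHom.mem_ker]
    ext
    have : f x = 0 := Ideal.Quotient.eq_zero_iff_mem.2 hx
    simp [hu, this]
  rw [hN, Subgroup.mem_bot] at this
  subst this
  simpa using hu.symm

lemma aux_field (D : Type) [DivisionRing D] [Finite D] (h : (1 : D) + 1 = 0) :
    ∃ k : ℕ, 1 ≤ k ∧ Nonempty (D ≃+* GaloisField 2 k) := by
  have : CharP D 2 := CharTwo.of_one_ne_zero_of_two_eq_zero one_ne_zero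
    (by rw [← one_add_one_eq_two]; exact h)
  let : Fintype D := Fintype.ofFinite D
  let F : Field D := littleWedderburn D
  obtain ⟨k, -, hk⟩ := FiniteField.card D 2
  refine ⟨k, k.2, ?_⟩
  let : Fintype (GaloisField 2 k) := Fintype.ofFinite _
  exact ⟨FiniteField.ringEquivOfCardEq (by
    rw [hk, ← Nat.card_eq_fintype_card, GaloisField.card 2 k k.2.ne'])⟩

/-- A finite ring of characteristic 2 whose unit group has trivial 2-core is isomorphic
to a finite direct product of matrix rings over finite fields of characteristic 2
(every finite field of characteristic 2 being `GaloisField 2 k` for some `k ≥ 1`). -/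
theorem stmt_1 (R : Type) [Ring R] [Finite R] (hchar : (1 : R) + 1 = 0)
    (h2core : ∀ N : Subgroup Rˣ, N.Normal → IsPGroup 2 N → N = ⊥) :
    ∃ (r : ℕ) (n k : Fin r → ℕ), (∀ i, 1 ≤ n i) ∧ (∀ i, 1 ≤ k i) ∧
      Nonempty (R ≃+* ∀ i : Fin r,
        Matrix (Fin (n i)) (Fin (n i)) (GaloisField 2 (k i))) := by
  have := aux_semisimple R hchar h2core
  obtain ⟨r, D, n, inst, hn, ⟨e⟩⟩ := IsSemisimpleRing.exists_ringEquiv_pi_matrix_divisionRing R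
  have hD : ∀ i, ∃ k : ℕ, 1 ≤ k ∧ Nonempty (D i ≃+* GaloisField 2 k) := by
    intro i
    have := hn i
    have hsurj : Function.Surjective
        (fun x : R => e x i 0 0) := by
      intro d
      let m : ∀ j, Matrix (Fin (n j)) (Fin (n j)) (D j) :=
        fun j _ _ => Function.update (fun _ => 0) i d j
      refine ⟨e.symm m, ?_⟩
      change e (e.symm m) i 0 0 = d
      rw [RingEquiv.apply_symm_apply]
      simp [m]
    have : Finite (D i) := Finite.of_surjective _ hsurj
    apply aux_field
    have h := congrArg e hchar
    rw [map_add, map_one, map_zero] at h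
    have h2 := congrFun (congrFun (congrFun h i) 0) 0
    simpa using h2
  choose k hk g using hD
  exact ⟨r, n, k, fun i => Nat.one_le_iff_ne_zero.2 (hn i).out, hk,
    ⟨e.trans (RingEquiv.piCongrRight fun i => (g i).some.mapMatrix)⟩⟩
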